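/- The process {Y_n} is (k-1)-exchangeable: for any two (k-1)-element subsets {n₁ < ⋯ < n_{k-1}} and {m₁ < ⋯ < m_{k-1}} of ℤ, the joint distribution under μ of (Y_{n₁}, …, Y_{n_{k-1}}) equals the joint distribution of (Y_{m₁}, …, Y_{m_{k-1}}). -/

import Mathlib

open Real MeasureTheory ProbabilityTheory

/-- The density `ψ` of the measure `ν` on `ℝ^k`. -/
noncomputable def psi (k : ℕ) (x : Fin k → ℝ) : ℝ :=
  (2 * Real.pi) ^ (-(k : ℝ) / 2) *
    (1 + (∏ i, x i) * Real.exp (-(∑ i, x i ^ 2) / 2)) *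
    Real.exp (-(∑ i, x i ^ 2) / 2)

/-- The measure `ν` on `ℝ^k` with density `ψ` with respect to Lebesgue measure. -/
noncomputable def nu (k : ℕ) : Measure (Fin k → ℝ) :=
  (volume : Measure (Fin k → ℝ)).withDensity fun x => ENNReal.ofReal (psi k x)

/-- `μ` is the joint law of an i.i.d. bilateral sequence `(X_{n,1},…,X_{n,k})`,
`n ∈ ℤ`, with common distribution `ν`: every finite-dimensional marginal of `μ`
is the corresponding finite product of copies of `ν`. -/
def IsIIDSeq (k : ℕ) (μ : Measure (ℤ → Fin k → ℝ)) : Prop :=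
  ∀ I : Finset ℤ, μ.map I.restrict = Measure.pi fun _ : I => nu k

/-- `Y n = X_{n,k} + X_{n+1,k-1} + ⋯ + X_{n+k-1,1}` (coordinates indexed by
`Fin k`, so coordinate `i ∈ {1,…,k}` corresponds to index `i-1 : Fin k`). -/
noncomputable def Y (k : ℕ) (n : ℤ) (ω : ℤ → Fin k → ℝ) : ℝ :=
  ∑ j : Fin k, ω (n + ((j : ℕ) : ℤ)) j.rev

/-- The density `ψ` is the standard Gaussian density plus a product of odd functions. -/
lemma psi_eq (k : ℕ) (x : Fin k → ℝ) :
    psi k x = ∏ i, gaussianPDFReal 0 1 (x i) +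
      (2 * Real.pi) ^ (-(k : ℝ) / 2) * ∏ i, (x i * Real.exp (-1 * x i ^ 2)) := by
  have hc : (2 * Real.pi) ^ (-(k : ℝ) / 2) = ∏ _i : Fin k, (√(2 * Real.pi))⁻¹ := by
    rw [Finset.prod_const, Finset.card_univ, Fintype.card_fin, Real.sqrt_eq_rpow,
      ← Real.rpow_neg (by positivity), ← Real.rpow_mul_natCast (by positivity)]
    congr 1
    ring
  have h1 : Real.exp (-(∑ i, x i ^ 2) / 2) = ∏ i, Real.exp (-x i ^ 2 / 2) := by
    rw [← Real.exp_sum, ← Finset.sum_div, Finset.sum_neg_distrib]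
  have h2 : (∏ i, Real.exp (-x i ^ 2 / 2)) * ∏ i, Real.exp (-x i ^ 2 / 2) =
      ∏ i, Real.exp (-1 * x i ^ 2) := by
    rw [← Finset.prod_mul_distrib]
    refine Finset.prod_congr rfl fun i _ => ?_
    rw [← Real.exp_add]
    ring_nf
  have h3 : ∏ i, gaussianPDFReal 0 1 (x i) =
      (2 * Real.pi) ^ (-(k : ℝ) / 2) * ∏ i, Real.exp (-x i ^ 2 / 2) := by
    rw [hc, ← Finset.prod_mul_distrib]
    simp [gaussianPDFReal]
  rw [h3, psi, h1, Finset.prod_mul_distrib, ← h2]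
  ring

lemma psi_nonneg (k : ℕ) (x : Fin k → ℝ) : 0 ≤ psi k x := by
  have hle : ∀ y : ℝ, |y * Real.exp (-y ^ 2 / 2)| ≤ 1 := fun y => by
    rw [abs_mul, Real.abs_exp, neg_div, Real.exp_neg, ← div_eq_mul_inv,
      div_le_one (Real.exp_pos _)]
    have := Real.add_one_le_exp (y ^ 2 / 2)
    nlinarith [sq_nonneg (|y| - 1), sq_abs y]
  have h : (∏ i, x i) * Real.exp (-(∑ i, x i ^ 2) / 2) =
      ∏ i, (x i * Real.exp (-x i ^ 2 / 2)) := by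
    rw [Finset.prod_mul_distrib, ← Real.exp_sum, ← Finset.sum_div, Finset.sum_neg_distrib]
  have habs : |(∏ i, x i) * Real.exp (-(∑ i, x i ^ 2) / 2)| ≤ 1 := by
    rw [h, Finset.abs_prod]
    exact Finset.prod_le_one (fun _ _ => abs_nonneg _) fun i _ => hle (x i)
  have := (abs_le.1 habs).1
  unfold psi
  have h1 : 0 ≤ 1 + (∏ i, x i) * Real.exp (-(∑ i, x i ^ 2) / 2) := by linarith
  positivity

instance (k : ℕ) : SigmaFinite (nu k) := by
  unfold nu; infer_instance

/-- At frequencies with a vanishing coordinate, the characteristic function of `ν` is that of the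
standard Gaussian. -/
lemma integral_cexp_nu {k : ℕ} (s : Fin k → ℝ) {i₀ : Fin k} (hs : s i₀ = 0) :
    ∫ x, Complex.exp ((∑ i, s i * x i : ℝ) * Complex.I) ∂nu k =
      Complex.exp ((-(∑ i, s i ^ 2) / 2 : ℝ)) := by
  have hmeas : Measurable fun x => ENNReal.ofReal (psi k x) := by unfold psi; fun_prop
  let e : Fin k → ℝ → ℂ := fun i y => Complex.exp ((s i * y : ℝ) * Complex.I)
  let g : Fin k → ℝ → ℂ := fun i y => (gaussianPDFReal 0 1 y : ℂ) * e i y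
  let o : Fin k → ℝ → ℂ := fun i y => ((y * Real.exp (-1 * y ^ 2) : ℝ) : ℂ) * e i y
  have hnorm : ∀ i y, ‖e i y‖ ≤ 1 := fun i y => (Complex.norm_exp_ofReal_mul_I _).le
  have he : ∀ i, AEStronglyMeasurable (e i) volume := fun i =>
    Continuous.aestronglyMeasurable (by fun_prop)
  have hg : ∀ i, Integrable (g i) volume := fun i =>
    (integrable_gaussianPDFReal 0 1).ofReal.mul_bdd (he i) (.of_forall (hnorm i))
  have ho : ∀ i, Integrable (o i) volume := fun i =>
    (integrable_mul_exp_neg_mul_sq one_pos).ofReal.mul_bdd (he i) (.of_forall (hnorm i))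
  have hg_int : ∀ i, ∫ y, g i y = Complex.exp ((-s i ^ 2 / 2 : ℝ)) := fun i => by
    have h := charFun_gaussianReal (μ := 0) (v := 1) (s i)
    rw [charFun_apply_real, integral_gaussianReal_eq_integral_smul one_ne_zero] at h
    simpa [g, e, neg_div] using h
  have ho_int : ∫ y, o i₀ y = 0 := by
    have h : ∀ y, o i₀ (-y) = -o i₀ y := fun y => by simp [o, e, hs]
    have h' := integral_neg_eq_self (o i₀) volume
    simp_rw [h, integral_neg] at h'
    exact self_eq_neg.1 h'.symm
  have hsplit : ∀ x : Fin k → ℝ,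
      (ENNReal.ofReal (psi k x)).toReal • Complex.exp ((∑ i, s i * x i : ℝ) * Complex.I) =
        ∏ i, g i (x i) + (((2 * Real.pi) ^ (-(k : ℝ) / 2) : ℝ) : ℂ) * ∏ i, o i (x i) := fun x => by
    have h : Complex.exp ((∑ i, s i * x i : ℝ) * Complex.I) = ∏ i, e i (x i) := by
      rw [Complex.ofReal_sum, Finset.sum_mul, Complex.exp_sum]
    rw [ENNReal.toReal_ofReal (psi_nonneg k x), h, psi_eq, Complex.real_smul]
    simp only [g, o, Finset.prod_mul_distrib, Complex.ofReal_add, Complex.ofReal_mul,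
      Complex.ofReal_prod]
    ring
  rw [nu, integral_withDensity_eq_integral_toReal_smul hmeas (.of_forall fun _ => by simp)]
  simp_rw [hsplit]
  have hgp : Integrable (fun x : Fin k → ℝ => ∏ i, g i (x i)) volume := Integrable.fintype_prod hg
  have hop : Integrable (fun x : Fin k → ℝ => ∏ i, o i (x i)) volume := Integrable.fintype_prod ho
  rw [integral_add hgp (hop.const_mul _), integral_const_mul,
    integral_fintype_prod_volume_eq_prod g, integral_fintype_prod_volume_eq_prod o,
    Finset.prod_eq_zero (f := fun i => ∫ y, o i y) (Finset.mem_univ i₀) ho_int]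
  simp_rw [hg_int]
  rw [mul_zero, add_zero, ← Complex.exp_sum, ← Complex.ofReal_sum, ← Finset.sum_div,
    Finset.sum_neg_distrib]

/-- Fewer than `k` of the variables `Y n` are jointly distributed as i.i.d. centred Gaussians of
variance `k`. -/
lemma charFunDual_map_Y {k : ℕ} {μ : Measure (ℤ → Fin k → ℝ)} (hμ : IsIIDSeq k μ)
    {ι : Type*} [Fintype ι] [DecidableEq ι] (hι : Fintype.card ι < k) (n : ι → ℤ)
    (hn : n.Injective) (L : StrongDual ℝ (ι → ℝ)) :
    charFunDual (μ.map fun ω i => Y k (n i) ω) L =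
      Complex.exp ((-(k * ∑ a, L (Pi.single a 1) ^ 2) / 2 : ℝ)) := by
  set t : ι → ℝ := fun a => L (Pi.single a 1) with ht
  have hmeas : Measurable fun ω (i : ι) => Y k (n i) ω := by unfold Y; fun_prop
  let s : ℤ → Fin k → ℝ := fun l i => ∑ a, if n a + (i.rev : ℕ) = l then t a else 0
  let I : Finset ℤ := Finset.univ.image fun p : ι × Fin k => n p.1 + (p.2.rev : ℕ)
  have hI : ∀ a (i : Fin k), n a + (i.rev : ℕ) ∈ I := fun a i =>
    Finset.mem_image_of_mem (fun p : ι × Fin k => n p.1 + (p.2.rev : ℕ)) (Finset.mem_univ (a, i))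
  have hzero : ∀ l, ∃ i, s l i = 0 := fun l => by
    by_contra! h
    have hex : ∀ i : Fin k, ∃ a, n a + (i.rev : ℕ) = l := fun i => by
      by_contra! h'
      exact h i (by simp [s, h', -Fin.val_rev])
    choose f hf using hex
    have hinj : f.Injective := fun i j hij => by
      have hi := hf i
      have hj := hf j
      rw [hij] at hi
      exact Fin.rev_injective (Fin.ext (by omega))
    have := Fintype.card_le_of_injective f hinj
    simp at this
    omega
  have hlin : ∀ ω : ℤ → Fin k → ℝ,
      L (fun a => Y k (n a) ω) = ∑ l : I, ∑ i, s l i * ω l i := fun ω => by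
    have hL : L (fun a => Y k (n a) ω) = ∑ a, Y k (n a) ω * t a := by
      conv_lhs => rw [pi_eq_sum_univ' (fun a => Y k (n a) ω)]
      simp [ht]
    have hY : ∀ a, Y k (n a) ω = ∑ i : Fin k, ω (n a + (i.rev : ℕ)) i := fun a => by
      rw [Y, ← Equiv.sum_comp Fin.revPerm]
      simp
    rw [hL, Finset.sum_coe_sort I fun l => ∑ i, s l i * ω l i, Finset.sum_comm]
    simp only [s, Finset.sum_mul, ite_mul, zero_mul]
    simp_rw [Finset.sum_comm (s := I), hY, Finset.sum_mul]
    rw [Finset.sum_comm]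
    refine Finset.sum_congr rfl fun i _ => Finset.sum_congr rfl fun a _ => ?_
    rw [Finset.sum_ite_eq, if_pos (hI a i), mul_comm]
  have hsq : ∑ l : I, ∑ i, s l i ^ 2 = k * ∑ a, t a ^ 2 := by
    have h : ∀ l i, s l i ^ 2 = ∑ a, if n a + (i.rev : ℕ) = l then t a ^ 2 else 0 := fun l i => by
      by_cases hex : ∃ a, n a + (i.rev : ℕ) = l
      · obtain ⟨a, rfl⟩ := hex
        simp [s, hn.eq_iff]
      · push Not at hex
        simp [s, hex, -Fin.val_rev]
    rw [Finset.sum_coe_sort I fun l => ∑ i, s l i ^ 2, Finset.sum_comm]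
    simp_rw [h, Finset.sum_comm (s := I)]
    simp [hI, -Fin.val_rev]
  have hres : Measurable (I.restrict : (ℤ → Fin k → ℝ) → _) := by fun_prop
  rw [charFunDual_apply, integral_map hmeas.aemeasurable (by fun_prop)]
  simp_rw [hlin]
  have key : ∫ ω, Complex.exp ((∑ l : I, ∑ i, s l i * ω l i : ℝ) * Complex.I) ∂μ =
      ∫ x : I → Fin k → ℝ, ∏ l : I, Complex.exp ((∑ i, s l i * x l i : ℝ) * Complex.I)
        ∂Measure.pi fun _ => nu k := by
    rw [← hμ I, integral_map hres.aemeasurable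
      (Continuous.aestronglyMeasurable (by fun_prop))]
    simp only [← Complex.exp_sum, ← Finset.sum_mul, ← Complex.ofReal_sum, Finset.restrict]
  rw [key, integral_fintype_prod_eq_prod
    (fun (l : I) (x : Fin k → ℝ) => Complex.exp ((∑ i, s l i * x i : ℝ) * Complex.I))]
  have hfac : ∀ l : I, ∫ x, Complex.exp ((∑ i, s l i * x i : ℝ) * Complex.I) ∂nu k =
      Complex.exp ((-(∑ i, s l i ^ 2) / 2 : ℝ)) := fun l => by
    obtain ⟨i, hi⟩ := hzero l
    exact integral_cexp_nu _ hi
  simp_rw [hfac]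
  rw [← Complex.exp_sum, ← Complex.ofReal_sum, ← Finset.sum_div, Finset.sum_neg_distrib, hsq]

/-- The process `{Y_n}` is `(k-1)`-exchangeable: any two increasing families of
`k-1` time points give rise to the same joint distribution. -/
theorem Y_kSubOne_exchangeable (k : ℕ) (hk : 1 < k)
    (μ : Measure (ℤ → Fin k → ℝ)) [IsProbabilityMeasure μ]
    (hμ : IsIIDSeq k μ)
    (n m : Fin (k - 1) → ℤ) (hn : StrictMono n) (hm : StrictMono m) :
    μ.map (fun ω (i : Fin (k - 1)) => Y k (n i) ω) =
      μ.map (fun ω (i : Fin (k - 1)) => Y k (m i) ω) := by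
  have hnm : Measurable fun ω (i : Fin (k - 1)) => Y k (n i) ω := by
    unfold Y; fun_prop
  have hmm : Measurable fun ω (i : Fin (k - 1)) => Y k (m i) ω := by
    unfold Y; fun_prop
  have := Measure.isProbabilityMeasure_map (μ := μ) hnm.aemeasurable
  have := Measure.isProbabilityMeasure_map (μ := μ) hmm.aemeasurable
  have hcard : Fintype.card (Fin (k - 1)) < k := by simp; omega
  refine Measure.ext_of_charFunDual (funext fun L => ?_)
  rw [charFunDual_map_Y hμ hcard n hn.injective L, charFunDual_map_Y hμ hcard m hm.injective L]
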